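/- arXiv:2508.06975 — 7 statements merged into one kernel-verified Lean document; each statement's English description precedes it below -/
import Mathlib

section
/- Let K ≥ 1, S > 0, and c : Fin K → ℝ with c k > 0 for every k. Suppose s* : Fin K → ℝ satisfies s* k > 0 and c k · s* k > 1 for all k, ∑_k s* k = S, and s* is a local minimum of the function s ↦ ∑_k 1/Real.log (c k · s k) restricted to the affine set {s : ∑_k s k = S} (equivalently, a local maximum of the high-SNR approximated total throughput (∑_k 1/(B·log₂(c_k s_k)))^{−1} on that set). Then √(s* k) · Real.log (c k · s* k) = √(s* j) · Real.log (c j · s* j) for all j, k. -/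
open Finset

/-- Lagrange multiplier rule for a separable objective: at a local minimum of `∑ i, φ i (s i)`
subject to a fixed total `∑ i, s i`, all the marginal derivatives agree. -/
theorem IsLocalMinOn.deriv_eq_of_sum_eq {ι : Type*} [Fintype ι] {φ : ι → ℝ → ℝ}
    {φ' a : ι → ℝ} {S : ℝ} (hsum : ∑ i, a i = S) (hφ : ∀ i, HasDerivAt (φ i) (φ' i) (a i))
    (hmin : IsLocalMinOn (fun s : ι → ℝ => ∑ i, φ i (s i)) {s | ∑ i, s i = S} a) (j k : ι) :
    φ' k = φ' j := by
  classical
  set v : ι → ℝ := Pi.single k 1 - Pi.single j 1 with hv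
  have hline : ∀ t : ℝ, a + t • v ∈ {s : ι → ℝ | ∑ i, s i = S} := fun t => by
    simp [hv, sum_add_distrib, ← mul_sum, hsum]
  have htend : Filter.Tendsto (fun t : ℝ => a + t • v) (nhds 0)
      (nhdsWithin a {s | ∑ i, s i = S}) := by
    refine tendsto_nhdsWithin_iff.2 ⟨?_, Filter.Eventually.of_forall hline⟩
    exact Continuous.tendsto' (by fun_prop) _ _ (by simp)
  have hloc : IsLocalMin (fun t : ℝ => ∑ i, φ i (a i + t * v i)) 0 := by
    filter_upwards [htend.eventually hmin] with t ht
    simpa using ht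
  have hderiv : HasDerivAt (fun t : ℝ => ∑ i, φ i (a i + t * v i)) (∑ i, φ' i * v i) 0 := by
    refine HasDerivAt.fun_sum fun i _ => ?_
    have hlin : HasDerivAt (fun t : ℝ => a i + t * v i) (v i) 0 := by
      simpa using ((hasDerivAt_id (0 : ℝ)).mul_const (v i)).const_add (a i)
    exact HasDerivAt.comp (0 : ℝ) (by simpa using hφ i) hlin
  have hzero := hloc.hasDerivAt_eq_zero hderiv
  simp only [hv, Pi.sub_apply, mul_sub, sum_sub_distrib, Pi.single_apply, mul_ite, mul_one,
    mul_zero, sum_ite_eq', mem_univ, if_true] at hzero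
  linarith

theorem hasDerivAt_one_div_log_const_mul {c x : ℝ} (hx : 0 < x) (hcx : 1 < c * x) :
    HasDerivAt (fun y => 1 / Real.log (c * y)) (-(1 / (x * Real.log (c * x) ^ 2))) x := by
  have hlog : Real.log (c * x) ≠ 0 := (Real.log_pos hcx).ne'
  have hcx0 : c * x ≠ 0 := (zero_lt_one.trans hcx).ne'
  have hc : c ≠ 0 := left_ne_zero_of_mul hcx0
  have h := (((hasDerivAt_id x).const_mul c).log hcx0).inv hlog
  simp only [one_div]
  refine h.congr_deriv ?_
  simp only [id_eq]
  field_simp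

/-- High-SNR power allocation (Proposition 1), first-order necessary condition:
a local minimizer of `s ↦ ∑ k, 1 / log (c k * s k)` on the affine set
`{s | ∑ k, s k = S}` with positive powers and per-hop SNR above 1 satisfies
`√(s k) * log (c k * s k) = √(s j) * log (c j * s j)` for all `j, k`. -/
theorem stmt1 (K : ℕ) (hK : 1 ≤ K) (S : ℝ) (hS : 0 < S)
    (c : Fin K → ℝ) (hc : ∀ k, 0 < c k)
    (sstar : Fin K → ℝ)
    (hpos : ∀ k, 0 < sstar k)
    (hsnr : ∀ k, 1 < c k * sstar k)
    (hsum : ∑ k, sstar k = S)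
    (hmin : IsLocalMinOn
      (fun s : Fin K → ℝ => ∑ k, 1 / Real.log (c k * s k))
      {s : Fin K → ℝ | ∑ k, s k = S} sstar) :
    ∀ j k, Real.sqrt (sstar k) * Real.log (c k * sstar k)
         = Real.sqrt (sstar j) * Real.log (c j * sstar j) := by
  intro j k
  have h := hmin.deriv_eq_of_sum_eq (φ := fun i x => 1 / Real.log (c i * x)) hsum
    (fun i => hasDerivAt_one_div_log_const_mul (hpos i) (hsnr i)) j k
  have hsq : sstar k * Real.log (c k * sstar k) ^ 2 = sstar j * Real.log (c j * sstar j) ^ 2 := by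
    simpa only [one_div, neg_inj, inv_inj] using h
  have hlog : ∀ i, 0 ≤ Real.log (c i * sstar i) := fun i => (Real.log_pos (hsnr i)).le
  refine (sq_eq_sq₀ (mul_nonneg (Real.sqrt_nonneg _) (hlog k))
    (mul_nonneg (Real.sqrt_nonneg _) (hlog j))).1 ?_
  rw [mul_pow, mul_pow, Real.sq_sqrt (hpos k).le, Real.sq_sqrt (hpos j).le, hsq]
end

section
/- Let K ≥ 1, S > 0, and c : Fin K → ℝ with c k > 0 for every k. Then there is at most one s : Fin K → ℝ such that s k > 0 and c k · s k ≥ 1 for all k, ∑_k s k = S, and √(s k) · Real.log (c k · s k) = √(s j) · Real.log (c j · s j) for all j, k. -/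
open Finset

theorem strictMonoOn_sqrt_mul_log {c : ℝ} (hc : 0 < c) :
    StrictMonoOn (fun x => Real.sqrt x * Real.log (c * x)) {x | 1 ≤ c * x} := by
  intro x (hx : 1 ≤ c * x) y _ hxy
  have hx0 : 0 < x := pos_of_mul_pos_right (by linarith) hc.le
  have hcxy : c * x < c * y := mul_lt_mul_of_pos_left hxy hc
  have hlog : Real.log (c * x) < Real.log (c * y) := Real.log_lt_log (by linarith) hcxy
  exact mul_lt_mul_of_le_of_lt_of_pos_of_nonneg (Real.sqrt_le_sqrt hxy.le) hlog
    (Real.sqrt_pos.2 hx0) ((Real.log_nonneg hx).trans hlog.le)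

/-- If two balanced allocations have the same total, neither exceeds the other on any hop:
exceeding it on one hop would mean exceeding it on all of them. -/
theorem le_of_balanced_of_sum_eq {ι : Type*} [Fintype ι] {c s t : ι → ℝ}
    (hc : ∀ k, 0 < c k) (hs : ∀ k, 1 ≤ c k * s k) (ht : ∀ k, 1 ≤ c k * t k)
    (hsum : ∑ k, s k = ∑ k, t k)
    (hsbal : ∀ j k, Real.sqrt (s k) * Real.log (c k * s k)
                  = Real.sqrt (s j) * Real.log (c j * s j))
    (htbal : ∀ j k, Real.sqrt (t k) * Real.log (c k * t k)
                  = Real.sqrt (t j) * Real.log (c j * t j)) (k : ι) :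
    t k ≤ s k := by
  by_contra! hk
  have hlt : ∀ j, s j < t j := fun j => by
    have h := strictMonoOn_sqrt_mul_log (hc k) (hs k) (ht k) hk
    simp only [hsbal j k, htbal j k] at h
    exact ((strictMonoOn_sqrt_mul_log (hc j)).lt_iff_lt (hs j) (ht j)).1 h
  exact (Finset.sum_lt_sum_of_nonempty ⟨k, Finset.mem_univ k⟩ fun j _ => hlt j).ne hsum

/-- Uniqueness of the high-SNR power allocation (Proposition 1): at most one
positive allocation with per-hop SNR at least 1, total power `S`, and balanced
`√(s k) * log (c k * s k)` across hops. -/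
theorem stmt2 (K : ℕ) (hK : 1 ≤ K) (S : ℝ) (hS : 0 < S)
    (c : Fin K → ℝ) (hc : ∀ k, 0 < c k)
    (s t : Fin K → ℝ)
    (hspos : ∀ k, 0 < s k) (hssnr : ∀ k, 1 ≤ c k * s k)
    (hssum : ∑ k, s k = S)
    (hsbal : ∀ j k, Real.sqrt (s k) * Real.log (c k * s k)
                  = Real.sqrt (s j) * Real.log (c j * s j))
    (htpos : ∀ k, 0 < t k) (htsnr : ∀ k, 1 ≤ c k * t k)
    (htsum : ∑ k, t k = S)
    (htbal : ∀ j k, Real.sqrt (t k) * Real.log (c k * t k)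
                  = Real.sqrt (t j) * Real.log (c j * t j)) :
    s = t := by
  have hsum : ∑ k, s k = ∑ k, t k := hssum.trans htsum.symm
  exact funext fun k => le_antisymm
    (le_of_balanced_of_sum_eq hc htsnr hssnr hsum.symm htbal hsbal k)
    (le_of_balanced_of_sum_eq hc hssnr htsnr hsum hsbal htbal k)
end

section
/- Let K ≥ 1, R > 0, S > 0, and let φ : ℝ → ℝ be differentiable and strictly positive on (0, ∞). Suppose (r*, s*) ∈ ℝ^K × ℝ^K satisfies r* k > 0, s* k > 0 and s* k · φ(r* k) > 1 for all k, ∑_k r* k = R, ∑_k s* k = S, and (r*, s*) is a local minimum of the function (r, s) ↦ ∑_k 1/Real.log (s k · φ(r k)) restricted to the set {(r, s) : ∑_k r k = R and ∑_k s k = S}. Then there exist constants C₁ and C₂ such that for every k: (Real.log (s* k · φ(r* k)))² · s* k = C₁ and (φ'(r* k)/φ(r* k)) / (Real.log (s* k · φ(r* k)))² = C₂. -/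
open Finset

/-- A linear functional on `ι → ℝ` vanishing on all zero-sum vectors has equal coefficients. -/
theorem coeff_eq_of_forall_sum_eq_zero {ι : Type*} [Fintype ι] [DecidableEq ι] {a : ι → ℝ}
    (h : ∀ v : ι → ℝ, ∑ k, v k = 0 → ∑ k, a k * v k = 0) (i j : ι) : a i = a j := by
  have := h (Pi.single i 1 - Pi.single j 1) (by simp)
  simpa [mul_sub, Finset.sum_sub_distrib, Pi.single_apply, sub_eq_zero] using this

/-- The derivative of the inverse logarithmic SNR of one hop along a line. -/
theorem hasDerivAt_one_div_log_snr {φ : ℝ → ℝ} {r s : ℝ} (u v : ℝ)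
    (hd : DifferentiableAt ℝ φ r) (hs : s ≠ 0) (hφ : φ r ≠ 0)
    (hlog : Real.log (s * φ r) ≠ 0) :
    HasDerivAt (fun t : ℝ => 1 / Real.log ((s + t * v) * φ (r + t * u)))
      (-((1 / (Real.log (s * φ r) ^ 2 * s)) * v
        + (deriv φ r / φ r / Real.log (s * φ r) ^ 2) * u)) 0 := by
  have line (a b : ℝ) : HasDerivAt (fun t : ℝ => a + t * b) b 0 := by
    simpa using ((hasDerivAt_id (0 : ℝ)).mul_const b).const_add a
  have hφ' : HasDerivAt (fun t : ℝ => φ (r + t * u)) (deriv φ r * u) 0 :=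
    HasDerivAt.comp (h₂ := φ) 0 (by simpa using hd.hasDerivAt) (line r u)
  have hlog' := ((line s v).mul hφ').log (by simp [hs, hφ])
  have hinv := hlog'.inv (by simpa using hlog)
  simp only [one_div]
  refine hinv.congr_deriv ?_
  simp only [Pi.mul_apply, zero_mul, add_zero]
  field_simp

/-- At a local minimizer of a function on a set, the derivative vanishes along every line
contained in that set. -/
theorem IsLocalMinOn.lineDeriv_eq_zero {E : Type*} [TopologicalSpace E] [AddCommGroup E]
    [Module ℝ E] [ContinuousAdd E] [ContinuousSMul ℝ E] {f : E → ℝ} {s : Set E} {x v : E} {f' : ℝ}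
    (h : IsLocalMinOn f s x) (hv : ∀ t : ℝ, x + t • v ∈ s)
    (hf : HasDerivAt (fun t : ℝ => f (x + t • v)) f' 0) : f' = 0 := by
  refine IsLocalMin.hasDerivAt_eq_zero ?_ hf
  have hcont : Continuous fun t : ℝ => x + t • v := by fun_prop
  have htend : Filter.Tendsto (fun t : ℝ => x + t • v) (nhds 0) (nhdsWithin x s) :=
    tendsto_nhdsWithin_iff.2
      ⟨by simpa using hcont.tendsto 0, Filter.Eventually.of_forall hv⟩
  simpa [IsLocalMin, IsMinFilter] using htend.eventually h

/-- Joint first-order (Lagrange) necessary condition for hop distances and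
powers in the high-SNR regime (Propositions 1 and 2): a local minimizer of
`(r, s) ↦ ∑ k, 1 / log (s k * φ (r k))` on the set
`{(r, s) | ∑ r k = R ∧ ∑ s k = S}` satisfies, for constants `C₁, C₂`,
`(log (s* k φ(r* k)))² s* k = C₁` and
`(φ'(r* k)/φ(r* k)) / (log (s* k φ(r* k)))² = C₂` for all `k`. -/
theorem stmt5 (K : ℕ) (hK : 1 ≤ K) (R S : ℝ) (hR : 0 < R) (hS : 0 < S)
    (φ : ℝ → ℝ)
    (hd : ∀ x ∈ Set.Ioi (0 : ℝ), DifferentiableAt ℝ φ x)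
    (hφpos : ∀ x ∈ Set.Ioi (0 : ℝ), 0 < φ x)
    (rstar sstar : Fin K → ℝ)
    (hrpos : ∀ k, 0 < rstar k) (hspos : ∀ k, 0 < sstar k)
    (hsnr : ∀ k, 1 < sstar k * φ (rstar k))
    (hsumr : ∑ k, rstar k = R) (hsums : ∑ k, sstar k = S)
    (hmin : IsLocalMinOn
      (fun p : (Fin K → ℝ) × (Fin K → ℝ) =>
        ∑ k, 1 / Real.log (p.2 k * φ (p.1 k)))
      {p : (Fin K → ℝ) × (Fin K → ℝ) |
        (∑ k, p.1 k = R) ∧ (∑ k, p.2 k = S)}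
      (rstar, sstar)) :
    ∃ C₁ C₂ : ℝ, ∀ k,
      (Real.log (sstar k * φ (rstar k))) ^ 2 * sstar k = C₁ ∧
      (deriv φ (rstar k) / φ (rstar k))
          / (Real.log (sstar k * φ (rstar k))) ^ 2 = C₂ := by
  have hlog k : Real.log (sstar k * φ (rstar k)) ≠ 0 := (Real.log_pos (hsnr k)).ne'
  have key (u v : Fin K → ℝ) (hu : ∑ k, u k = 0) (hv : ∑ k, v k = 0) :
      ∑ k, -((1 / (Real.log (sstar k * φ (rstar k)) ^ 2 * sstar k)) * v k
        + (deriv φ (rstar k) / φ (rstar k) / Real.log (sstar k * φ (rstar k)) ^ 2) * u k) = 0 := by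
    refine hmin.lineDeriv_eq_zero (v := (u, v)) (fun t => ?_) ?_
    · simp [Finset.sum_add_distrib, ← Finset.mul_sum, hu, hv, hsumr, hsums]
    · simpa using HasDerivAt.fun_sum fun k (_ : k ∈ Finset.univ) =>
        hasDerivAt_one_div_log_snr (u k) (v k) (hd _ (hrpos k)) (hspos k).ne'
          (hφpos _ (hrpos k)).ne' (hlog k)
  have hpower := coeff_eq_of_forall_sum_eq_zero
      (a := fun k => 1 / (Real.log (sstar k * φ (rstar k)) ^ 2 * sstar k)) fun v hv => by
    simpa using key 0 v (by simp) hv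
  have hdist := coeff_eq_of_forall_sum_eq_zero
      (a := fun k => deriv φ (rstar k) / φ (rstar k) / Real.log (sstar k * φ (rstar k)) ^ 2)
      fun u hu => by
    simpa using key u 0 hu (by simp)
  let k₀ : Fin K := ⟨0, hK⟩
  refine ⟨Real.log (sstar k₀ * φ (rstar k₀)) ^ 2 * sstar k₀,
    deriv φ (rstar k₀) / φ (rstar k₀) / Real.log (sstar k₀ * φ (rstar k₀)) ^ 2,
    fun k => ⟨?_, hdist k k₀⟩⟩
  exact inv_injective (by simpa only [one_div] using hpower k k₀)
end

section
/- Let β > 0, R > 0, A > 0 and B > 0. Then: (i) there exists a unique K̃ > 0 satisfying the transcendental equation 2βR/K̃ − Real.log A + 1 = Real.log K̃; and (ii) the function τ(K) = (B/(K · Real.log 2)) · (Real.log A + Real.log K − βR/K) is strictly monotonically increasing on (0, K̃] and strictly monotonically decreasing on [K̃, ∞), so K̃ is its unique global maximizer on (0, ∞). -/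
open Set

theorem strictMonoOn_log_sub_div {c : ℝ} (hc : 0 < c) :
    StrictMonoOn (fun x : ℝ => Real.log x - c / x) (Ioi 0) := by
  intro x hx y _ hxy
  have h₁ : Real.log x < Real.log y := Real.log_lt_log hx hxy
  have h₂ : c / y < c / x := div_lt_div_of_pos_left hc hx hxy
  dsimp only
  linarith

theorem exists_pos_log_sub_div_eq {c : ℝ} (hc : 0 < c) (a : ℝ) :
    ∃ x : ℝ, 0 < x ∧ Real.log x - c / x = a := by
  have hcont : ContinuousOn (fun x : ℝ => Real.log x - c / x)
      (Icc (Real.exp (-|a|)) (Real.exp (c + |a|))) := by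
    intro x hx
    have hx0 : x ≠ 0 := ((Real.exp_pos _).trans_le hx.1).ne'
    exact ((Real.continuousAt_log hx0).sub
      (continuousAt_const.div continuousAt_id hx0)).continuousWithinAt
  have hle : Real.exp (-|a|) ≤ Real.exp (c + |a|) :=
    Real.exp_le_exp.2 (by linarith [abs_nonneg a])
  have hleft : Real.log (Real.exp (-|a|)) - c / Real.exp (-|a|) ≤ a := by
    have := div_pos hc (Real.exp_pos (-|a|))
    rw [Real.log_exp]
    linarith [neg_abs_le a]
  have hright : a ≤ Real.log (Real.exp (c + |a|)) - c / Real.exp (c + |a|) := by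
    have := div_le_self hc.le (Real.one_le_exp (by positivity : 0 ≤ c + |a|))
    rw [Real.log_exp]
    linarith [le_abs_self a]
  obtain ⟨x, hx, hxa⟩ := intermediate_value_Icc hle hcont ⟨hleft, hright⟩
  exact ⟨x, (Real.exp_pos _).trans_le hx.1, hxa⟩

theorem hasDerivAt_throughput (B l c : ℝ) {x : ℝ} (hx : 0 < x) :
    HasDerivAt (fun K : ℝ => (B / (K * Real.log 2)) * (l + Real.log K - c / K))
      (B / (x ^ 2 * Real.log 2) * (1 - l - (Real.log x - 2 * c / x))) x := by
  have hlog2 : Real.log 2 ≠ 0 := (Real.log_pos one_lt_two).ne'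
  have h₁ : HasDerivAt (fun K : ℝ => B / (K * Real.log 2)) _ x :=
    (hasDerivAt_const x B).div ((hasDerivAt_id x).mul_const (Real.log 2))
      (mul_ne_zero hx.ne' hlog2)
  have h₂ : HasDerivAt (fun K : ℝ => l + Real.log K - c / K) _ x :=
    ((Real.hasDerivAt_log hx.ne').const_add l).sub
      ((hasDerivAt_const x c).div (hasDerivAt_id x) hx.ne')
  refine (h₁.mul h₂).congr_deriv ?_
  field_simp
  ring

/-- Number of hops design, THz high-SNR case (Proposition 3, Case 2): there is
a unique `K̃ > 0` with `2βR/K̃ − log A + 1 = log K̃`, and the throughput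
`τ(K) = (B / (K log 2)) (log A + log K − βR/K)` is strictly increasing on
`(0, K̃]` and strictly decreasing on `[K̃, ∞)`, so `K̃` is the unique global
maximizer of `τ` on `(0, ∞)`. -/
theorem stmt8 (β R A B : ℝ) (hβ : 0 < β) (hR : 0 < R) (hA : 0 < A) (hB : 0 < B) :
    ∃ Kt : ℝ, 0 < Kt ∧
      (2 * β * R / Kt - Real.log A + 1 = Real.log Kt) ∧
      (∀ K : ℝ, 0 < K → (2 * β * R / K - Real.log A + 1 = Real.log K) → K = Kt) ∧
      StrictMonoOn
        (fun K : ℝ => (B / (K * Real.log 2)) *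
          (Real.log A + Real.log K - β * R / K)) (Set.Ioc 0 Kt) ∧
      StrictAntiOn
        (fun K : ℝ => (B / (K * Real.log 2)) *
          (Real.log A + Real.log K - β * R / K)) (Set.Ici Kt) ∧
      (∀ K ∈ Set.Ioi (0 : ℝ), K ≠ Kt →
        (B / (K * Real.log 2)) * (Real.log A + Real.log K - β * R / K)
          < (B / (Kt * Real.log 2)) * (Real.log A + Real.log Kt - β * R / Kt)) := by
  have h2c : 0 < 2 * (β * R) := by positivity
  have hlog2 : 0 < Real.log 2 := Real.log_pos one_lt_two
  obtain ⟨Kt, hKt, heq⟩ := exists_pos_log_sub_div_eq h2c (1 - Real.log A)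
  have hg := strictMonoOn_log_sub_div h2c
  have hcont : ∀ K : ℝ, 0 < K → ContinuousAt (fun K : ℝ => (B / (K * Real.log 2)) *
      (Real.log A + Real.log K - β * R / K)) K :=
    fun K hK => (hasDerivAt_throughput B (Real.log A) (β * R) hK).continuousAt
  have hmono : StrictMonoOn (fun K : ℝ => (B / (K * Real.log 2)) *
      (Real.log A + Real.log K - β * R / K)) (Ioc 0 Kt) := by
    refine strictMonoOn_of_deriv_pos (convex_Ioc 0 Kt)
      (fun K hK => (hcont K hK.1).continuousWithinAt) fun K hK => ?_
    rw [interior_Ioc] at hK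
    rw [(hasDerivAt_throughput B (Real.log A) (β * R) hK.1).deriv]
    have hlt := hg (mem_Ioi.2 hK.1) (mem_Ioi.2 hKt) hK.2
    have hK0 := hK.1
    exact mul_pos (by positivity) (by dsimp only at hlt; linarith)
  have hanti : StrictAntiOn (fun K : ℝ => (B / (K * Real.log 2)) *
      (Real.log A + Real.log K - β * R / K)) (Ici Kt) := by
    refine strictAntiOn_of_deriv_neg (convex_Ici Kt)
      (fun K hK => (hcont K (hKt.trans_le hK)).continuousWithinAt) fun K hK => ?_
    rw [interior_Ici] at hK
    have hK0 : 0 < K := hKt.trans hK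
    rw [(hasDerivAt_throughput B (Real.log A) (β * R) hK0).deriv]
    have hlt := hg (mem_Ioi.2 hKt) (mem_Ioi.2 hK0) hK
    exact mul_neg_of_pos_of_neg (by positivity) (by dsimp only at hlt; linarith)
  refine ⟨Kt, hKt, ?_, fun K hK hKeq => ?_, hmono, hanti, fun K hK hne => ?_⟩
  · rw [mul_assoc]
    linarith
  · rw [mul_assoc] at hKeq
    exact hg.injOn hK hKt (by linarith)
  · rcases hne.lt_or_gt with hlt | hgt
    · exact hmono ⟨hK, hlt.le⟩ ⟨hKt, le_rfl⟩ hlt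
    · exact hanti self_mem_Ici hgt.le hgt
end

section
/- Let β > 1, R > 0, A > 0 and B > 0, and define τ(K) = (B/(K · Real.log 2)) · (Real.log A + (β−1) · Real.log K − β · Real.log R) for K > 0. Then K̃ = (R^β · exp(β−1) / A)^{1/(β−1)} is the unique positive solution of K · (R/K)^β = exp(1 − β + Real.log A), and τ is strictly monotonically increasing on (0, K̃] and strictly monotonically decreasing on [K̃, ∞); hence K̃ is the unique global maximizer of τ on (0, ∞). -/
/-- The elementary inequality behind the increase of `(1 + log (x / k)) / x` on `(0, k]`. -/
lemma mul_one_add_log_sub_lt_of_le {k x y : ℝ} (hx : 0 < x) (hxy : x < y) (hyk : y ≤ k) :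
    y * (1 + Real.log x - Real.log k) < x * (1 + Real.log y - Real.log k) := by
  have hy : 0 < y := hx.trans hxy
  have hk : 0 < k := hy.trans_le hyk
  have h₁ : Real.log x - Real.log y < x / y - 1 := by
    rw [← Real.log_div hx.ne' hy.ne']
    exact Real.log_lt_sub_one_of_pos (by positivity) ((div_lt_one hy).2 hxy).ne
  have h₂ : Real.log x - Real.log k ≤ x / k - 1 := by
    rw [← Real.log_div hx.ne' hk.ne']
    exact Real.log_le_sub_one_of_pos (by positivity)
  have h₃ : x / k ≤ x / y := div_le_div_of_nonneg_left hx.le hy hyk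
  have h₄ : x * (1 - x / y) = (y - x) * (x / y) := by field_simp
  have h₅ : (y - x) * (1 + Real.log x - Real.log k) ≤ (y - x) * (x / y) :=
    mul_le_mul_of_nonneg_left (by linarith) (by linarith)
  have h₆ : x * (1 - x / y) < x * (Real.log y - Real.log x) :=
    mul_lt_mul_of_pos_left (by linarith) hx
  linarith

/-- The elementary inequality behind the decrease of `(1 + log (x / k)) / x` on `[k, ∞)`. -/
lemma mul_one_add_log_sub_lt_of_ge {k x y : ℝ} (hk : 0 < k) (hkx : k ≤ x) (hxy : x < y) :
    x * (1 + Real.log y - Real.log k) < y * (1 + Real.log x - Real.log k) := by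
  have hx : 0 < x := hk.trans_le hkx
  have hy : 0 < y := hx.trans hxy
  have h₁ : Real.log y - Real.log x < y / x - 1 := by
    rw [← Real.log_div hy.ne' hx.ne']
    exact Real.log_lt_sub_one_of_pos (by positivity) ((one_lt_div hx).2 hxy).ne'
  have h₂ : Real.log k ≤ Real.log x := Real.log_le_log hk hkx
  have h₃ : x * (y / x - 1) = y - x := by field_simp
  have h₄ : 0 ≤ (y - x) * (Real.log x - Real.log k) :=
    mul_nonneg (by linarith) (by linarith)
  have h₅ : x * (Real.log y - Real.log x) < x * (y / x - 1) := mul_lt_mul_of_pos_left h₁ hx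
  linarith

/-- Number of hops design, RF high-SNR case (Proposition 3, Case 4): with
`K̃ = (R^β exp (β−1) / A)^(1/(β−1))`, `K̃` is the unique positive solution of
`K (R/K)^β = exp (1 − β + log A)`, and
`τ(K) = (B/(K log 2)) (log A + (β−1) log K − β log R)` is strictly increasing
on `(0, K̃]`, strictly decreasing on `[K̃, ∞)`, hence uniquely maximized at
`K̃` on `(0, ∞)`. -/
theorem stmt9 (β R A B : ℝ) (hβ : 1 < β) (hR : 0 < R) (hA : 0 < A) (hB : 0 < B) :
    let τ : ℝ → ℝ := fun K =>
      (B / (K * Real.log 2)) *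
        (Real.log A + (β - 1) * Real.log K - β * Real.log R)
    let Kt : ℝ := (R ^ β * Real.exp (β - 1) / A) ^ (1 / (β - 1))
    (0 < Kt) ∧
    (Kt * (R / Kt) ^ β = Real.exp (1 - β + Real.log A)) ∧
    (∀ K : ℝ, 0 < K → K * (R / K) ^ β = Real.exp (1 - β + Real.log A) → K = Kt) ∧
    StrictMonoOn τ (Set.Ioc 0 Kt) ∧
    StrictAntiOn τ (Set.Ici Kt) ∧
    (∀ K ∈ Set.Ioi (0 : ℝ), K ≠ Kt → τ K < τ Kt) := by
  intro τ Kt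
  have hc : 0 < β - 1 := sub_pos.2 hβ
  have hRβ : 0 < R ^ β := Real.rpow_pos_of_pos hR β
  have hKt : 0 < Kt := by positivity
  have hlog : (β - 1) * Real.log Kt = β * Real.log R + (β - 1) - Real.log A := by
    simp only [Kt]
    rw [Real.log_rpow (by positivity), Real.log_div (by positivity) hA.ne',
      Real.log_mul hRβ.ne' (Real.exp_pos _).ne', Real.log_exp, Real.log_rpow hR]
    field_simp
  have hroot : ∀ K : ℝ, 0 < K →
      (K * (R / K) ^ β = Real.exp (1 - β + Real.log A) ↔ K = Kt) := by
    intro K hK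
    have hpos : 0 < (R / K) ^ β := Real.rpow_pos_of_pos (by positivity) β
    have hlogK : Real.log (K * (R / K) ^ β)
        = Real.log K + β * (Real.log R - Real.log K) := by
      rw [Real.log_mul hK.ne' hpos.ne', Real.log_rpow (by positivity),
        Real.log_div hR.ne' hK.ne']
    rw [← Real.log_injOn_pos.eq_iff (Set.mem_Ioi.2 (mul_pos hK hpos))
      (Set.mem_Ioi.2 (Real.exp_pos _)), Real.log_exp, hlogK,
      ← Real.log_injOn_pos.eq_iff (Set.mem_Ioi.2 hK) (Set.mem_Ioi.2 hKt)]
    constructor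
    · intro h
      exact mul_left_cancel₀ hc.ne' (by linarith)
    · intro h
      rw [h]
      linarith
  have hlog2 : 0 < Real.log 2 := Real.log_pos one_lt_two
  have hτ : ∀ K : ℝ, τ K
      = B * (β - 1) / Real.log 2 * ((1 + Real.log K - Real.log Kt) / K) := by
    intro K
    have h : Real.log A + (β - 1) * Real.log K - β * Real.log R
        = (β - 1) * (1 + Real.log K - Real.log Kt) := by linarith
    simp only [τ]
    rw [h]
    ring
  have hscale : 0 < B * (β - 1) / Real.log 2 := by positivity
  have hmono : StrictMonoOn τ (Set.Ioc 0 Kt) := by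
    intro x hx y hy hxy
    rw [hτ, hτ]
    refine mul_lt_mul_of_pos_left ?_ hscale
    rw [div_lt_div_iff₀ hx.1 hy.1]
    linarith [mul_one_add_log_sub_lt_of_le hx.1 hxy hy.2]
  have hanti : StrictAntiOn τ (Set.Ici Kt) := by
    intro x hx y hy hxy
    rw [hτ, hτ]
    refine mul_lt_mul_of_pos_left ?_ hscale
    rw [div_lt_div_iff₀ (hKt.trans_le hy) (hKt.trans_le hx)]
    linarith [mul_one_add_log_sub_lt_of_ge hKt hx hxy]
  refine ⟨hKt, (hroot Kt hKt).2 rfl, fun K hK => (hroot K hK).1, hmono, hanti, ?_⟩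
  intro K hK hne
  rcases hne.lt_or_gt with h | h
  · exact hmono ⟨hK, h.le⟩ ⟨hKt, le_rfl⟩ h
  · exact hanti Set.self_mem_Ici h.le h
end

section
/- Fix λ > 0, r > 0 and 0 < ρ < r. Define F(ρ) = ∫_{r−ρ}^{r+ρ} 2λ·l·exp(−λπ l²)·Real.arccos((r² + l² − ρ²)/(2 r l)) dl. Then the function l ↦ (2λρ·exp(−λπ l²)) / (r·√(1 − ((r² + l² − ρ²)/(2 r l))²)) is interval-integrable on [r−ρ, r+ρ], and F is differentiable at ρ with derivative F′(ρ) = ∫_{r−ρ}^{r+ρ} (2λρ·exp(−λπ l²)) / (r·√(1 − ((r² + l² − ρ²)/(2 r l))²)) dl. -/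
open MeasureTheory

namespace TypeIDistance

open Set

open scoped Interval

/-- The cosine of the angle between the sides of lengths `r` and `l` in a triangle whose third
side has length `x`. -/
noncomputable def cosAngle (r x l : ℝ) : ℝ := (r ^ 2 + l ^ 2 - x ^ 2) / (2 * r * l)

/-- The derivative of `x ↦ arccos (cosAngle r x (r + x * t))` on `(0, r)`, for `t ∈ [-1, 1]`. -/
noncomputable def angleDeriv (r x t : ℝ) : ℝ :=
  √(1 - t ^ 2) * (2 * r + x * t) / ((r + x * t) * √((2 * r + x * t) ^ 2 - x ^ 2))

/-- The derivative of `x ↦ x * (h (r + x * t) * arccos (cosAngle r x (r + x * t)))` on `(0, r)`,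
for `t ∈ [-1, 1]` and a function `h` with derivative `h'`. -/
noncomputable def rescaledDeriv (h h' : ℝ → ℝ) (r x t : ℝ) : ℝ :=
  (h (r + x * t) + x * t * h' (r + x * t)) * Real.arccos (cosAngle r x (r + x * t)) +
    x * h (r + x * t) * angleDeriv r x t

variable {r x t : ℝ}

lemma add_mul_pos (hx : 0 < x) (hxr : x < r) (ht : t ∈ Icc (-1 : ℝ) 1) : 0 < r + x * t := by
  nlinarith [ht.1]

lemma sq_sub_sq_pos (hx : 0 < x) (hxr : x < r) (ht : t ∈ Icc (-1 : ℝ) 1) :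
    0 < (2 * r + x * t) ^ 2 - x ^ 2 := by
  nlinarith [add_mul_pos hx hxr ht]

lemma one_sub_cosAngle_sq (hr : r ≠ 0) (hl : r + x * t ≠ 0) :
    1 - cosAngle r x (r + x * t) ^ 2 =
      (1 - t ^ 2) * x ^ 2 * ((2 * r + x * t) ^ 2 - x ^ 2) / (2 * r * (r + x * t)) ^ 2 := by
  unfold cosAngle
  field_simp
  ring

lemma cosAngle_eq_one (hr : r ≠ 0) (hl : r + x * t ≠ 0) (ht : t ^ 2 = 1) :
    cosAngle r x (r + x * t) = 1 := by
  unfold cosAngle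
  field_simp
  linear_combination (x ^ 2) * ht

lemma one_sub_cosAngle_sq_pos (hx : 0 < x) (hxr : x < r) (ht : t ∈ Ioo (-1 : ℝ) 1) :
    0 < 1 - cosAngle r x (r + x * t) ^ 2 := by
  have hr : 0 < r := hx.trans hxr
  have hl := add_mul_pos hx hxr (Ioo_subset_Icc_self ht)
  have hq := sq_sub_sq_pos hx hxr (Ioo_subset_Icc_self ht)
  have h1 : 0 < 1 - t ^ 2 := by nlinarith [ht.1, ht.2]
  rw [one_sub_cosAngle_sq hr.ne' hl.ne']
  positivity

lemma angleDeriv_eq (hx : 0 < x) (hxr : x < r) (ht : t ∈ Ioo (-1 : ℝ) 1) :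
    angleDeriv r x t = (1 - t ^ 2) * x * (2 * r + x * t) /
      (2 * r * (r + x * t) ^ 2 * √(1 - cosAngle r x (r + x * t) ^ 2)) := by
  have hr : 0 < r := hx.trans hxr
  have hl := add_mul_pos hx hxr (Ioo_subset_Icc_self ht)
  have hq := sq_sub_sq_pos hx hxr (Ioo_subset_Icc_self ht)
  have h1 : 0 < 1 - t ^ 2 := by nlinarith [ht.1, ht.2]
  rw [one_sub_cosAngle_sq hr.ne' hl.ne', Real.sqrt_div (by positivity),
    Real.sqrt_mul (by positivity), Real.sqrt_mul h1.le, Real.sqrt_sq hx.le,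
    Real.sqrt_sq (by positivity), angleDeriv]
  have hs := Real.sq_sqrt h1.le
  have hs0 := Real.sqrt_pos.2 h1
  have hq0 := Real.sqrt_pos.2 hq
  set s := √(1 - t ^ 2)
  rw [← hs]
  field_simp

lemma hasDerivAt_arccos_comp {u : ℝ → ℝ} {u' s : ℝ} (hu : HasDerivAt u u' s)
    (h : 0 < 1 - u s ^ 2) :
    HasDerivAt (fun s => Real.arccos (u s)) (-(1 / √(1 - u s ^ 2)) * u') s :=
  (Real.hasDerivAt_arccos (by intro h'; norm_num [h'] at h) (by intro h'; norm_num [h'] at h)).comp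
    s hu

lemma hasDerivAt_cosAngle_radius (hr : r ≠ 0) (hl : r + x * t ≠ 0) :
    HasDerivAt (fun x => cosAngle r x (r + x * t))
      (-((1 - t ^ 2) * x * (2 * r + x * t) / (2 * r * (r + x * t) ^ 2))) x := by
  have hlin : HasDerivAt (fun x => r + x * t) t x := by
    simpa using ((hasDerivAt_id x).mul_const t).const_add r
  refine ((((hlin.pow 2).const_add (r ^ 2)).sub ((hasDerivAt_id x).pow 2)).div
    (hlin.const_mul (2 * r)) (by positivity)).congr_deriv ?_
  simp
  field_simp
  ring

lemma hasDerivAt_cosAngle_param (hr : r ≠ 0) (hl : r + x * t ≠ 0) :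
    HasDerivAt (fun t => cosAngle r x (r + x * t))
      (x ^ 2 * (2 * r * t + x * t ^ 2 + x) / (2 * r * (r + x * t) ^ 2)) t := by
  have hlin : HasDerivAt (fun t => r + x * t) x t := by
    simpa using ((hasDerivAt_id t).const_mul x).const_add r
  refine ((((hlin.pow 2).const_add (r ^ 2)).sub_const (x ^ 2)).div
    (hlin.const_mul (2 * r)) (by positivity)).congr_deriv ?_
  simp
  field_simp
  ring

lemma hasDerivAt_arccos_cosAngle (hx : 0 < x) (hxr : x < r) (ht : t ∈ Icc (-1 : ℝ) 1) :
    HasDerivAt (fun x => Real.arccos (cosAngle r x (r + x * t))) (angleDeriv r x t) x := by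
  have hr : 0 < r := hx.trans hxr
  have hl := add_mul_pos hx hxr ht
  by_cases ht1 : t ^ 2 = 1
  · have h0 : angleDeriv r x t = 0 := by simp [angleDeriv, ht1]
    rw [h0]
    refine (hasDerivAt_const x (0 : ℝ)).congr_of_eventuallyEq ?_
    filter_upwards [Ioo_mem_nhds hx hxr] with y hy
    rw [cosAngle_eq_one hr.ne' (add_mul_pos hy.1 hy.2 ht).ne' ht1, Real.arccos_one]
  · have ht' : t ∈ Ioo (-1 : ℝ) 1 :=
      ⟨ht.1.lt_of_ne fun h => ht1 (by rw [← h]; norm_num),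
        ht.2.lt_of_ne fun h => ht1 (by rw [h]; norm_num)⟩
    have hS := one_sub_cosAngle_sq_pos hx hxr ht'
    refine (hasDerivAt_arccos_comp (hasDerivAt_cosAngle_radius hr.ne' hl.ne') hS).congr_deriv ?_
    rw [angleDeriv_eq hx hxr ht']
    have hS0 := Real.sqrt_pos.2 hS
    field_simp

variable {h h' : ℝ → ℝ}

lemma hasDerivAt_rescaled (hh : ∀ l, HasDerivAt h (h' l) l) (hx : 0 < x) (hxr : x < r)
    (ht : t ∈ Icc (-1 : ℝ) 1) :
    HasDerivAt (fun x => x * (h (r + x * t) * Real.arccos (cosAngle r x (r + x * t))))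
      (rescaledDeriv h h' r x t) x := by
  have hlin : HasDerivAt (fun x => r + x * t) t x := by
    simpa using ((hasDerivAt_id x).mul_const t).const_add r
  refine ((hasDerivAt_id x).mul (((hh (r + x * t)).comp x hlin).mul
    (hasDerivAt_arccos_cosAngle hx hxr ht))).congr_deriv ?_
  simp [rescaledDeriv]
  ring

lemma continuousOn_arccos_cosAngle :
    ContinuousOn (fun p : ℝ × ℝ => Real.arccos (cosAngle r p.1 (r + p.1 * p.2)))
      (Ioo 0 r ×ˢ Icc (-1) 1) := by
  refine Real.continuous_arccos.comp_continuousOn ?_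
  unfold cosAngle
  refine ContinuousOn.div (by fun_prop) (by fun_prop) ?_
  rintro ⟨x, t⟩ ⟨hx, ht⟩
  have hl := add_mul_pos hx.1 hx.2 ht
  have hr : 0 < r := hx.1.trans hx.2
  simp only
  positivity

lemma continuousOn_angleDeriv :
    ContinuousOn (fun p : ℝ × ℝ => angleDeriv r p.1 p.2) (Ioo 0 r ×ˢ Icc (-1) 1) := by
  unfold angleDeriv
  refine ContinuousOn.div (by fun_prop) (by fun_prop) ?_
  rintro ⟨x, t⟩ ⟨hx, ht⟩
  exact mul_ne_zero (add_mul_pos hx.1 hx.2 ht).ne'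
    (Real.sqrt_pos.2 (sq_sub_sq_pos hx.1 hx.2 ht)).ne'

lemma continuousOn_rescaledDeriv (hc : Continuous h) (hc' : Continuous h') :
    ContinuousOn (fun p : ℝ × ℝ => rescaledDeriv h h' r p.1 p.2) (Ioo 0 r ×ˢ Icc (-1) 1) := by
  unfold rescaledDeriv
  exact (ContinuousOn.mul (by fun_prop) continuousOn_arccos_cosAngle).add
    (ContinuousOn.mul (by fun_prop) continuousOn_angleDeriv)

lemma continuousOn_pair {f : ℝ × ℝ → ℝ} (hf : ContinuousOn f (Ioo 0 r ×ˢ Icc (-1) 1))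
    (hx : x ∈ Ioo 0 r) : ContinuousOn (fun t => f (x, t)) (Icc (-1) 1) :=
  hf.comp (by fun_prop) fun _ ht => ⟨hx, ht⟩

lemma continuousOn_mul_arccos (hc : Continuous h) (hx : x ∈ Ioo 0 r) :
    ContinuousOn (fun t => h (r + x * t) * Real.arccos (cosAngle r x (r + x * t)))
      (Icc (-1) 1) :=
  ContinuousOn.mul (by fun_prop) (continuousOn_pair continuousOn_arccos_cosAngle hx)

lemma intervalIntegrable_of_continuousOn_Icc {f : ℝ → ℝ} (hf : ContinuousOn f (Icc (-1) 1)) :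
    IntervalIntegrable f volume (-1) 1 :=
  (by rwa [uIcc_of_le (by norm_num)] : ContinuousOn f (uIcc (-1) 1)).intervalIntegrable

/-- Differentiation under the integral sign after rescaling the domain to `[-1, 1]`. -/
lemma hasDerivAt_integral_rescaled (hh : ∀ l, HasDerivAt h (h' l) l) (hc' : Continuous h')
    (hx : x ∈ Ioo 0 r) :
    HasDerivAt (fun x => ∫ l in (r - x)..(r + x), h l * Real.arccos (cosAngle r x l))
      (∫ t in (-1)..1, rescaledDeriv h h' r x t) x := by
  have hc : Continuous h := continuous_iff_continuousAt.2 fun l => (hh l).continuousAt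
  have hscale : ∀ y : ℝ, ∫ l in (r - y)..(r + y), h l * Real.arccos (cosAngle r y l) =
      ∫ t in (-1)..1, y * (h (r + y * t) * Real.arccos (cosAngle r y (r + y * t))) := by
    intro y
    have := intervalIntegral.smul_integral_comp_add_mul (a := -1) (b := 1)
      (fun l => h l * Real.arccos (cosAngle r y l)) y r
    rw [intervalIntegral.integral_const_mul, ← smul_eq_mul, this]
    congr 1 <;> ring
  simp_rw [hscale]
  have hI : Ι (-1 : ℝ) 1 ⊆ Icc (-1) 1 := by
    rw [uIoc_of_le (by norm_num)]
    exact Ioc_subset_Icc_self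
  have hcont : ∀ y ∈ Ioo 0 r, ContinuousOn
      (fun t => y * (h (r + y * t) * Real.arccos (cosAngle r y (r + y * t)))) (Icc (-1) 1) :=
    fun y hy => continuousOn_const.mul (continuousOn_mul_arccos hc hy)
  obtain ⟨a, ha⟩ := exists_between hx.1
  obtain ⟨b, hb⟩ := exists_between hx.2
  have hsub : Icc a b ⊆ Ioo 0 r := fun y hy => ⟨ha.1.trans_le hy.1, hy.2.trans_lt hb.2⟩
  have hD := continuousOn_rescaledDeriv (r := r) hc hc'
  obtain ⟨C, hC⟩ := (isCompact_Icc.prod isCompact_Icc).exists_bound_of_continuousOn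
    (hD.mono (prod_mono_left (t := Icc (-1 : ℝ) 1) hsub))
  refine (intervalIntegral.hasDerivAt_integral_of_dominated_loc_of_deriv_le
    (F' := rescaledDeriv h h' r) (bound := fun _ => C)
    (Icc_mem_nhds ha.2 hb.1) ?_ (intervalIntegrable_of_continuousOn_Icc (hcont x hx)) ?_ ?_
    intervalIntegrable_const ?_).2
  · filter_upwards [Ioo_mem_nhds hx.1 hx.2] with y hy
    exact ((hcont y hy).mono hI).aestronglyMeasurable measurableSet_uIoc
  · exact ((continuousOn_pair hD hx).mono hI).aestronglyMeasurable measurableSet_uIoc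
  · exact ae_of_all _ fun t ht y hy => hC (y, t) ⟨hy, hI ht⟩
  · exact ae_of_all _ fun t ht y hy =>
      hasDerivAt_rescaled hh (hsub hy).1 (hsub hy).2 (hI ht)

/-- The rescaled density is integrable, and its integral is that of `rescaledDeriv`, as the two
differ by the derivative of a function vanishing at both ends. -/
lemma integral_rescaledDeriv (hh : ∀ l, HasDerivAt h (h' l) l) (hc' : Continuous h')
    (hpos : ∀ l, 0 < l → 0 ≤ h l) (hx : x ∈ Ioo 0 r) :
    IntervalIntegrable (fun t => x * (h (r + x * t) * x /
        (r * (r + x * t) * √(1 - cosAngle r x (r + x * t) ^ 2)))) volume (-1) 1 ∧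
      ∫ t in (-1)..1, x * (h (r + x * t) * x /
          (r * (r + x * t) * √(1 - cosAngle r x (r + x * t) ^ 2))) =
        ∫ t in (-1)..1, rescaledDeriv h h' r x t := by
  have hc : Continuous h := continuous_iff_continuousAt.2 fun l => (hh l).continuousAt
  have hr : 0 < r := hx.1.trans hx.2
  have hx0 := hx.1
  have hD := continuousOn_pair (continuousOn_rescaledDeriv hc hc') hx
  have hDint := intervalIntegrable_of_continuousOn_Icc hD
  set g : ℝ → ℝ := fun t => (∫ s in (-1)..t, rescaledDeriv h h' r x s) -
    t * (h (r + x * t) * Real.arccos (cosAngle r x (r + x * t))) with hg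
  have hgc : ContinuousOn g (Icc (-1) 1) := by
    refine ContinuousOn.sub ?_ (continuousOn_id.mul (continuousOn_mul_arccos hc hx))
    have := intervalIntegral.continuousOn_primitive_interval' hDint left_mem_uIcc
    rwa [uIcc_of_le (by norm_num)] at this
  have hgd : ∀ t ∈ Ioo (-1 : ℝ) 1, HasDerivAt g (x * (h (r + x * t) * x /
      (r * (r + x * t) * √(1 - cosAngle r x (r + x * t) ^ 2)))) t := by
    intro t ht
    have hl := add_mul_pos hx.1 hx.2 (Ioo_subset_Icc_self ht)
    have hS := one_sub_cosAngle_sq_pos hx.1 hx.2 ht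
    have hlin : HasDerivAt (fun t => r + x * t) x t := by
      simpa using ((hasDerivAt_id t).const_mul x).const_add r
    have hDo := hD.mono Ioo_subset_Icc_self
    have hprim := intervalIntegral.integral_hasDerivAt_right
      (hDint.mono_set (uIcc_subset_uIcc_left (by
        rw [uIcc_of_le (by norm_num)]; exact Ioo_subset_Icc_self ht)))
      (hDo.stronglyMeasurableAtFilter isOpen_Ioo t ht)
      (hDo.continuousAt (isOpen_Ioo.mem_nhds ht))
    refine (hprim.sub ((hasDerivAt_id t).mul (((hh (r + x * t)).comp t hlin).mul
      (hasDerivAt_arccos_comp (hasDerivAt_cosAngle_param hr.ne' hl.ne') hS)))).congr_deriv ?_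
    have hS0 := Real.sqrt_pos.2 hS
    simp only [rescaledDeriv, angleDeriv_eq hx.1 hx.2 ht, id, Function.comp, Pi.mul_apply]
    generalize √(1 - cosAngle r x (r + x * t) ^ 2) = S at hS0 ⊢
    field_simp
    ring
  have hint := intervalIntegral.intervalIntegrable_deriv_of_nonneg (a := -1) (b := 1)
    (by rwa [uIcc_of_le (by norm_num)]) (by simpa using hgd) (by
      intro t ht
      have hl := add_mul_pos hx.1 hx.2 (t := t) (Ioo_subset_Icc_self (by simpa using ht))
      have := hpos _ hl
      positivity)
  refine ⟨hint, ?_⟩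
  rw [intervalIntegral.integral_eq_sub_of_hasDerivAt_of_le (by norm_num) hgc hgd hint]
  have h1 := cosAngle_eq_one (x := x) (t := 1) hr.ne'
    (add_mul_pos hx.1 hx.2 (by norm_num)).ne' (by norm_num)
  have h2 := cosAngle_eq_one (x := x) (t := -1) hr.ne'
    (add_mul_pos hx.1 hx.2 (by norm_num)).ne' (by norm_num)
  simp only [hg, h1, h2, Real.arccos_one, intervalIntegral.integral_same]
  ring

/-- Leibniz rule for the integral over `[r - x, r + x]` of a nonnegative weight times the angle
opposite to the side `x`: the boundary terms vanish. -/
theorem intervalIntegrable_and_hasDerivAt_integral_arccos (hh : ∀ l, HasDerivAt h (h' l) l)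
    (hc' : Continuous h') (hpos : ∀ l, 0 < l → 0 ≤ h l) (hx : x ∈ Ioo 0 r) :
    IntervalIntegrable (fun l => h l * x / (r * l * √(1 - cosAngle r x l ^ 2)))
        volume (r - x) (r + x) ∧
      HasDerivAt (fun x => ∫ l in (r - x)..(r + x), h l * Real.arccos (cosAngle r x l))
        (∫ l in (r - x)..(r + x), h l * x / (r * l * √(1 - cosAngle r x l ^ 2))) x := by
  obtain ⟨hint, heq⟩ := integral_rescaledDeriv hh hc' hpos hx
  constructor
  · have hx0 : x ≠ 0 := hx.1.ne'
    have := ((hint.const_mul x⁻¹).comp_mul_left (c := x⁻¹)).comp_add_right (-r)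
    refine (this.congr ?_)
      |> fun H => by convert H using 1 <;> field_simp <;> ring
    intro l _
    have hl : r + x * (x⁻¹ * (l + -r)) = l := by field_simp; ring
    simp only [hl]
    field_simp
  · convert hasDerivAt_integral_rescaled hh hc' hx using 1
    rw [← heq, intervalIntegral.integral_const_mul, ← smul_eq_mul,
      intervalIntegral.smul_integral_comp_add_mul
        (fun l => h l * x / (r * l * √(1 - cosAngle r x l ^ 2)))]
    congr 1 <;> ring

end TypeIDistance

open MeasureTheory

/-- Lemma 1 (type-I distance distribution): differentiating the CDF
`F(ρ) = ∫_{r−ρ}^{r+ρ} 2λ l exp (−λπl²) arccos ((r²+l²−ρ²)/(2rl)) dl`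
under the integral sign (Leibniz's rule) yields the density
`f(ρ) = ∫_{r−ρ}^{r+ρ} (2λρ exp (−λπl²)) / (r √(1 − ((r²+l²−ρ²)/(2rl))²)) dl`,
the integrand of which is interval-integrable. -/
theorem stmt10 (lam r ρ : ℝ) (hlam : 0 < lam) (hr : 0 < r)
    (hρ : 0 < ρ) (hρr : ρ < r) :
    IntervalIntegrable
      (fun l : ℝ => (2 * lam * ρ * Real.exp (-(lam * Real.pi * l ^ 2))) /
        (r * Real.sqrt (1 - ((r ^ 2 + l ^ 2 - ρ ^ 2) / (2 * r * l)) ^ 2)))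
      volume (r - ρ) (r + ρ) ∧
    HasDerivAt
      (fun x : ℝ => ∫ l in (r - x)..(r + x),
        2 * lam * l * Real.exp (-(lam * Real.pi * l ^ 2)) *
          Real.arccos ((r ^ 2 + l ^ 2 - x ^ 2) / (2 * r * l)))
      (∫ l in (r - ρ)..(r + ρ),
        (2 * lam * ρ * Real.exp (-(lam * Real.pi * l ^ 2))) /
          (r * Real.sqrt (1 - ((r ^ 2 + l ^ 2 - ρ ^ 2) / (2 * r * l)) ^ 2)))
      ρ := by
  have hderiv : ∀ l : ℝ, HasDerivAt
      (fun l : ℝ => 2 * lam * l * Real.exp (-(lam * Real.pi * l ^ 2)))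
      (2 * lam * Real.exp (-(lam * Real.pi * l ^ 2)) * (1 - 2 * lam * Real.pi * l ^ 2)) l := by
    intro l
    refine (((hasDerivAt_id l).const_mul (2 * lam)).mul
      (((hasDerivAt_id l).pow 2).const_mul (lam * Real.pi)).neg.exp).congr_deriv ?_
    simp
    ring
  obtain ⟨h₁, h₂⟩ := TypeIDistance.intervalIntegrable_and_hasDerivAt_integral_arccos hderiv
    (by fun_prop) (fun l hl => by positivity) (Set.mem_Ioo.2 ⟨hρ, hρr⟩)
  have hcongr : ∀ l ∈ Set.uIcc (r - ρ) (r + ρ),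
      2 * lam * l * Real.exp (-(lam * Real.pi * l ^ 2)) * ρ /
          (r * l * √(1 - TypeIDistance.cosAngle r ρ l ^ 2)) =
        (2 * lam * ρ * Real.exp (-(lam * Real.pi * l ^ 2))) /
          (r * √(1 - ((r ^ 2 + l ^ 2 - ρ ^ 2) / (2 * r * l)) ^ 2)) := by
    intro l hl
    rw [Set.uIcc_of_le (by linarith)] at hl
    have hl0 : l ≠ 0 := by linarith [hl.1]
    unfold TypeIDistance.cosAngle
    rw [← mul_div_mul_left _ (r * √_) hl0]
    congr 1 <;> ring
  refine ⟨h₁.congr fun l hl => hcongr l (Set.uIoc_subset_uIcc hl), ?_⟩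
  rw [← intervalIntegral.integral_congr hcongr]
  exact h₂
end

section
/- For all B > 0, c > 0, α > 0, μ > 0 and m̄ > 0: ∫_{0}^{∞} B · Real.logb 2 (1 + c·x) · (α·μ^μ·x^{αμ/2−1}/(2·m̄^{αμ/2}·Γ(μ))) · exp(−μ·(x/m̄)^{α/2}) dx = ∫_{0}^{∞} (1/Γ(μ)) · ( ∫_{μ·((2^{t/B}−1)/(c·m̄))^{α/2}}^{∞} u^{μ−1}·exp(−u) du ) dt. -/
open MeasureTheory

/-- Layer-cake formula with respect to an integrable weight `w` on a set `s`; no integrability of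
`f * w` is required. -/
theorem setIntegral_mul_eq_integral_setIntegral_superlevel {s : Set ℝ} {f w : ℝ → ℝ}
    (hs : MeasurableSet s) (hf : Measurable f) (hf0 : ∀ x ∈ s, 0 ≤ f x)
    (hw : IntegrableOn w s) (hwm : Measurable w) (hw0 : ∀ x ∈ s, 0 ≤ w x) :
    ∫ x in s, f x * w x = ∫ t in Set.Ioi (0 : ℝ), ∫ x in {x | t < f x} ∩ s, w x := by
  set P : Measure ℝ := (volume.restrict s).withDensity (fun x ↦ ENNReal.ofReal (w x)) with hP
  have hPfin : IsFiniteMeasure P := isFiniteMeasure_withDensity_ofReal hw.2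
  have hf0P : 0 ≤ᵐ[P] f :=
    (withDensity_absolutelyContinuous _ _).ae_le (ae_restrict_of_forall_mem hs hf0)
  have hset (t : ℝ) : MeasurableSet {x | t < f x} := measurableSet_lt measurable_const hf
  have tail (t : ℝ) : ∫ x in {x | t < f x} ∩ s, w x = (P {x | t < f x}).toReal := by
    rw [hP, withDensity_apply _ (hset t), Measure.restrict_restrict (hset t),
      integral_eq_lintegral_of_nonneg_ae _ hwm.aestronglyMeasurable]
    exact ae_restrict_of_forall_mem ((hset t).inter hs) fun x hx ↦ hw0 x hx.2
  have lhs : ∫ x in s, f x * w x = ∫ x, f x ∂P := by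
    rw [hP, integral_withDensity_eq_integral_toReal_smul hwm.ennreal_ofReal
      (Filter.Eventually.of_forall fun _ ↦ ENNReal.ofReal_lt_top)]
    refine setIntegral_congr_fun hs fun x hx ↦ ?_
    simp [ENNReal.toReal_ofReal (hw0 x hx), mul_comm]
  have anti : Antitone fun t ↦ P {x | t < f x} :=
    fun a b hab ↦ measure_mono fun x (hx : b < f x) ↦ hab.trans_lt hx
  simp_rw [tail]
  rw [lhs, integral_eq_lintegral_of_nonneg_ae hf0P hf.aestronglyMeasurable,
    lintegral_eq_lintegral_meas_lt P hf0P hf.aemeasurable,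
    integral_toReal anti.measurable.aemeasurable
      (Filter.Eventually.of_forall fun _ ↦ measure_lt_top _ _)]

/-- Substitution `u = k * x ^ p` in an integral against the Gamma weight. -/
theorem integral_mul_gamma_weight_eq {k p a : ℝ} (hk : 0 < k) (hp : 0 < p) (f : ℝ → ℝ) :
    ∫ u in Set.Ioi (0 : ℝ), f u * (u ^ (a - 1) * Real.exp (-u)) =
      ∫ x in Set.Ioi (0 : ℝ), f (k * x ^ p) *
        (p * k ^ a * x ^ (p * a - 1) * Real.exp (-(k * x ^ p))) := by
  have h := integral_comp_mul_left_Ioi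
    (fun u : ℝ ↦ f u * (u ^ (a - 1) * Real.exp (-u))) 0 hk
  rw [mul_zero, smul_eq_mul, eq_inv_mul_iff_mul_eq₀ hk.ne'] at h
  rw [← h, ← integral_comp_rpow_Ioi_of_pos hp, ← integral_const_mul]
  refine setIntegral_congr_fun measurableSet_Ioi fun x (hx : 0 < x) ↦ ?_
  have e1 : k ^ a = k * k ^ (a - 1) := by
    rw [Real.rpow_sub_one hk.ne']; field_simp
  have e2 : x ^ (p * a - 1) = x ^ (p - 1) * (x ^ p) ^ (a - 1) := by
    rw [← Real.rpow_mul hx.le, ← Real.rpow_add hx]; ring_nf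
  simp only [smul_eq_mul]
  rw [Real.mul_rpow hk.le (by positivity), e1, e2]
  ring

/-- Superlevel sets of the Shannon rate as a function of the normalized fading power `u`. -/
theorem lt_mul_logb_one_add_iff {B d k p t u : ℝ} (hB : 0 < B) (hd : 0 < d) (hk : 0 < k)
    (hp : 0 < p) (ht : 0 ≤ t) (hu : 0 < u) :
    t < B * Real.logb 2 (1 + d * (u / k) ^ p⁻¹) ↔
      k * (((2 : ℝ) ^ (t / B) - 1) / d) ^ p < u := by
  have hy : 0 ≤ (2 : ℝ) ^ (t / B) - 1 :=
    sub_nonneg.2 (Real.one_le_rpow one_le_two (by positivity))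
  rw [← div_lt_iff₀' hB, Real.lt_logb_iff_rpow_lt one_lt_two (by positivity),
    ← sub_lt_iff_lt_add', ← div_lt_iff₀' hd, ← lt_div_iff₀' hk,
    Real.lt_rpow_inv_iff_of_pos (by positivity) (by positivity) hp]

/-- Single-hop THz throughput identity (Theorem 2): with α–μ fading and SNR
`c·X`, the ergodic throughput `E[B log₂ (1 + c X)]` equals the layer-cake
integral of the SNR complementary CDF
`Γ(μ, μ ((2^{t/B}−1)/(c m̄))^{α/2}) / Γ(μ)`. -/
theorem stmt13 (B c α μ mbar : ℝ) (hB : 0 < B) (hc : 0 < c)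
    (hα : 0 < α) (hμ : 0 < μ) (hmbar : 0 < mbar) :
    (∫ x in Set.Ioi (0 : ℝ),
        B * Real.logb 2 (1 + c * x) *
          ((α * μ ^ μ * x ^ (α * μ / 2 - 1) /
              (2 * mbar ^ (α * μ / 2) * Real.Gamma μ)) *
            Real.exp (-(μ * (x / mbar) ^ (α / 2)))))
      = ∫ t in Set.Ioi (0 : ℝ),
          (1 / Real.Gamma μ) *
            ∫ u in Set.Ioi (μ * (((2 : ℝ) ^ (t / B) - 1) / (c * mbar)) ^ (α / 2)),
              u ^ (μ - 1) * Real.exp (-u) := by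
  have hp : 0 < α / 2 := by positivity
  have hd : 0 < c * mbar := by positivity
  let rate : ℝ → ℝ := fun u ↦ B * Real.logb 2 (1 + c * mbar * (u / μ) ^ (α / 2)⁻¹)
  have hrate : Measurable rate := by
    simp only [rate, Real.logb]; fun_prop
  have hrate0 : ∀ u ∈ Set.Ioi (0 : ℝ), 0 ≤ rate u := fun u (hu : 0 < u) ↦
    mul_nonneg hB.le (Real.logb_nonneg one_lt_two (le_add_of_nonneg_right (by positivity)))
  have hw : IntegrableOn (fun u : ℝ ↦ u ^ (μ - 1) * Real.exp (-u)) (Set.Ioi 0) := by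
    simpa only [mul_comm] using Real.GammaIntegral_convergent hμ
  have hsub := integral_mul_gamma_weight_eq (k := μ / mbar ^ (α / 2)) (a := μ)
    (by positivity) hp rate
  rw [setIntegral_mul_eq_integral_setIntegral_superlevel measurableSet_Ioi hrate hrate0 hw
    (by fun_prop) fun u (hu : 0 < u) ↦ by positivity] at hsub
  rw [integral_const_mul]
  have htail : ∀ t ∈ Set.Ioi (0 : ℝ), {u | t < rate u} ∩ Set.Ioi 0 =
      Set.Ioi (μ * (((2 : ℝ) ^ (t / B) - 1) / (c * mbar)) ^ (α / 2)) := by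
    intro t (ht : 0 < t)
    have hy : 0 ≤ (2 : ℝ) ^ (t / B) - 1 :=
      sub_nonneg.2 (Real.one_le_rpow one_le_two (by positivity))
    ext u
    constructor
    · rintro ⟨h, hu⟩
      exact (lt_mul_logb_one_add_iff hB hd hμ hp ht.le hu).1 h
    · intro h
      have hu : 0 < u := lt_of_le_of_lt (by positivity) h
      exact ⟨(lt_mul_logb_one_add_iff hB hd hμ hp ht.le hu).2 h, hu⟩
  rw [setIntegral_congr_fun measurableSet_Ioi fun t ht ↦ congrArg
    (fun s ↦ ∫ u in s, u ^ (μ - 1) * Real.exp (-u)) (htail t ht)] at hsub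
  rw [hsub, ← integral_const_mul]
  refine setIntegral_congr_fun measurableSet_Ioi fun x (hx : 0 < x) ↦ ?_
  have hdiv : μ / mbar ^ (α / 2) * x ^ (α / 2) = μ * (x / mbar) ^ (α / 2) := by
    rw [Real.div_rpow hx.le hmbar.le]; ring
  have hr : rate (μ * (x / mbar) ^ (α / 2)) = B * Real.logb 2 (1 + c * x) := by
    simp only [rate]
    rw [mul_div_cancel_left₀ _ hμ.ne', Real.rpow_rpow_inv (by positivity) hp.ne',
      mul_assoc, mul_div_cancel₀ _ hmbar.ne']
  have hexp : α / 2 * μ = α * μ / 2 := by ring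
  simp only [hdiv, hr]
  rw [Real.div_rpow hμ.le (by positivity), ← Real.rpow_mul hmbar.le, hexp]
  have := Real.Gamma_pos_of_pos hμ
  field_simp
end
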